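/- arXiv:1508.01760 — 2 statements merged into one kernel-verified Lean document; each statement's English description precedes it below -/
import Mathlib

section
/- Let z ∈ ℂ satisfy −1 < Re(z) ≤ 0. There exists a constant C > 0 depending only on z (in particular independent of β) such that for every integer β ≥ 3 and all reals x ≥ 3 one has | Σ'_{n ≤ x} σ_{z,β}(n) − ζ(β(1−z))·x | ≤ C · x^{1/3}(log x)^2. -/
open Complex Finset
open scoped Classical

/-- The generalized divisor function `σ_{z,β}(n) = Σ_{d^β ∣ n} d^{βz}`. -/
noncomputable def sigmaGen (z : ℂ) (β : ℕ) (n : ℕ) : ℂ :=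
  ∑ d ∈ (Finset.Icc 1 n).filter (fun d => d ^ β ∣ n), (d : ℂ) ^ ((β : ℂ) * z)

/-- The primed sum `Σ'_{n ≤ x} f(n)`: subtract `f(x)/2` when `x` is a positive integer. -/
noncomputable def primedSum (f : ℕ → ℂ) (x : ℝ) : ℂ :=
  (∑ n ∈ Finset.Icc 1 ⌊x⌋₊, f n) - (if (⌊x⌋₊ : ℝ) = x then f ⌊x⌋₊ / 2 else 0)

/-- A quantity bounded by both `1` and `(t / (n + 1)) ^ 3` is dominated by a telescoping term. -/
lemma le_telescoping_of_le_one_of_le_cube {t a : ℝ} (ht : 0 < t) (n : ℕ) (ha : a ≤ 1)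
    (hat : a ≤ t ^ 3 / ((n : ℝ) + 1) ^ 3) :
    a ≤ 4 * t ^ 2 * (1 / (t + n) - 1 / (t + (n + 1 : ℕ))) := by
  have hn : (0 : ℝ) ≤ n := n.cast_nonneg
  have key : 4 * t ^ 2 * (1 / (t + n) - 1 / (t + (n + 1 : ℕ)))
      = 4 * t ^ 2 / ((t + n) * (t + n + 1)) := by
    push_cast
    have h1 : t + n ≠ 0 := by positivity
    have h2 : t + (n + 1) ≠ 0 := by positivity
    have h3 : t + n + 1 ≠ 0 := by positivity
    field_simp
    ring
  rw [key]
  rcases le_total ((n : ℝ) + 1) t with h | h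
  · refine ha.trans ?_
    rw [le_div_iff₀ (by positivity)]
    nlinarith
  · refine hat.trans ?_
    calc t ^ 3 / ((n : ℝ) + 1) ^ 3 ≤ t ^ 2 * (n + 1) / ((n : ℝ) + 1) ^ 3 := by
          gcongr
          nlinarith [sq_nonneg t]
      _ = 4 * t ^ 2 / ((2 * (n + 1)) * (2 * ((n : ℝ) + 1))) := by
          field_simp
          norm_num
      _ ≤ _ := by
          gcongr <;> linarith

lemma sum_range_telescoping_le {t : ℝ} (ht : 0 < t) (K : ℕ) :
    ∑ n ∈ Finset.range K, 4 * t ^ 2 * (1 / (t + n) - 1 / (t + (n + 1 : ℕ))) ≤ 4 * t := by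
  rw [← Finset.mul_sum, Finset.sum_range_sub' (fun n : ℕ => 1 / (t + (n : ℝ)))]
  have h : 0 ≤ 1 / (t + (K : ℝ)) := by positivity
  calc 4 * t ^ 2 * (1 / (t + (0 : ℕ)) - 1 / (t + (K : ℝ)))
      ≤ 4 * t ^ 2 * (1 / t) := by
        gcongr
        simpa using h
    _ = 4 * t := by field_simp

/-- Bound for a series whose terms are at most both `1` and `(t / (n + 1)) ^ 3`. -/
lemma sum_range_le_of_le_one_of_le_cube {t : ℝ} (ht : 0 < t) {a : ℕ → ℝ} (ha : ∀ n, a n ≤ 1)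
    (hat : ∀ n : ℕ, a n ≤ t ^ 3 / ((n : ℝ) + 1) ^ 3) (K : ℕ) :
    ∑ n ∈ Finset.range K, a n ≤ 4 * t :=
  (Finset.sum_le_sum fun n _ => le_telescoping_of_le_one_of_le_cube ht n (ha n) (hat n)).trans
    (sum_range_telescoping_le ht K)

lemma norm_natCast_succ_cpow_le_one (n : ℕ) {s : ℂ} (hs : s.re ≤ 0) :
    ‖((n + 1 : ℕ) : ℂ) ^ s‖ ≤ 1 := by
  rw [Complex.norm_natCast_cpow_of_pos n.succ_pos]
  exact Real.rpow_le_one_of_one_le_of_nonpos (by simp) hs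

lemma sigmaGen_eq_sum_range (z : ℂ) {β : ℕ} (hβ : β ≠ 0) {n N : ℕ} (hn : 0 < n) (hN : n ≤ N) :
    sigmaGen z β n = ∑ k ∈ Finset.range N,
      if (k + 1) ^ β ∣ n then ((k + 1 : ℕ) : ℂ) ^ ((β : ℂ) * z) else 0 := by
  have h : (Finset.Icc 1 n).filter (fun d => d ^ β ∣ n)
      = (Finset.Ico 1 (N + 1)).filter (fun d => d ^ β ∣ n) := by
    ext d
    simp only [Finset.mem_filter, Finset.mem_Icc, Finset.mem_Ico]
    constructor
    · rintro ⟨⟨h1, h2⟩, h3⟩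
      exact ⟨⟨h1, by omega⟩, h3⟩
    · rintro ⟨⟨h1, -⟩, h3⟩
      exact ⟨⟨h1, Nat.le_of_dvd hn ((dvd_pow_self d hβ).trans h3)⟩, h3⟩
  rw [sigmaGen, h, Finset.sum_filter, Finset.sum_Ico_eq_sum_range]
  simp [add_comm]

lemma sum_sigmaGen_eq (z : ℂ) {β : ℕ} (hβ : β ≠ 0) (N : ℕ) :
    ∑ n ∈ Finset.Icc 1 N, sigmaGen z β n =
      ∑ k ∈ Finset.range N, ((k + 1 : ℕ) : ℂ) ^ ((β : ℂ) * z) * (N / (k + 1) ^ β : ℕ) := by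
  have h : ∀ n ∈ Finset.Icc 1 N, sigmaGen z β n = ∑ k ∈ Finset.range N,
      if (k + 1) ^ β ∣ n then ((k + 1 : ℕ) : ℂ) ^ ((β : ℂ) * z) else 0 := fun n hn =>
    sigmaGen_eq_sum_range z hβ (Finset.mem_Icc.1 hn).1 (Finset.mem_Icc.1 hn).2
  rw [Finset.sum_congr rfl h, Finset.sum_comm]
  refine Finset.sum_congr rfl fun k _ => ?_
  rw [← Finset.sum_filter, Finset.sum_const, nsmul_eq_mul, mul_comm, ← Nat.Ioc_filter_dvd_card_eq_div]
  rfl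

/-- The series of differences between the divisor counts and their smooth approximations. -/
lemma hasSum_sum_sigmaGen_sub (z : ℂ) (hz : z.re ≤ 0) {β : ℕ} (hβ : 2 ≤ β) (N : ℕ) (x : ℝ) :
    HasSum (fun k : ℕ => ((k + 1 : ℕ) : ℂ) ^ ((β : ℂ) * z) *
        (((N / (k + 1) ^ β : ℕ) : ℂ) - (x : ℂ) / ((k + 1 : ℕ) : ℂ) ^ β))
      (∑ n ∈ Finset.Icc 1 N, sigmaGen z β n - riemannZeta ((β : ℂ) * (1 - z)) * x) := by
  have hβ' : (2 : ℝ) ≤ β := by exact_mod_cast hβ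
  have hre : 1 < ((β : ℂ) * (1 - z)).re := by
    simp
    nlinarith
  have hfin : HasSum (fun k : ℕ =>
      ((k + 1 : ℕ) : ℂ) ^ ((β : ℂ) * z) * ((N / (k + 1) ^ β : ℕ) : ℂ))
      (∑ n ∈ Finset.Icc 1 N, sigmaGen z β n) := by
    rw [sum_sigmaGen_eq z (by omega)]
    refine hasSum_sum_of_ne_finset_zero fun k hk => ?_
    have hlt : N < (k + 1) ^ β :=
      (Nat.lt_succ_of_le (not_lt.1 (by simpa using hk))).trans_le
        (Nat.le_self_pow (by omega) _)
    simp [Nat.div_eq_of_lt hlt]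
  have hsumm : Summable fun k : ℕ => 1 / ((k : ℂ) + 1) ^ ((β : ℂ) * (1 - z)) := by
    have := (summable_nat_add_iff 1).2 (Complex.summable_one_div_nat_cpow.2 hre)
    simpa using this
  have hzeta := (zeta_eq_tsum_one_div_nat_add_one_cpow hre) ▸ hsumm.hasSum
  refine (hfin.sub (hzeta.mul_right (x : ℂ))).congr_fun ?_
  intro k
  have hk : ((k : ℂ) + 1) ≠ 0 := Nat.cast_add_one_ne_zero k
  have hsub : ((k : ℂ) + 1) ^ ((β : ℂ) * (1 - z))
      = ((k : ℂ) + 1) ^ β / ((k : ℂ) + 1) ^ ((β : ℂ) * z) := by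
    rw [mul_sub, mul_one, Complex.cpow_sub _ _ hk, Complex.cpow_natCast]
  rw [hsub]
  push_cast
  rw [one_div_div]
  ring

lemma norm_natCast_floor_div_sub_le {x : ℝ} (hx : 0 ≤ x) {D : ℕ} :
    ‖((⌊x⌋₊ / D : ℕ) : ℂ) - (x : ℂ) / (D : ℂ)‖ ≤ 1 ∧
      ‖((⌊x⌋₊ / D : ℕ) : ℂ) - (x : ℂ) / (D : ℂ)‖ ≤ x / D := by
  have hx' : 0 ≤ x / D := by positivity
  have h1 : ((⌊x⌋₊ / D : ℕ) : ℝ) ≤ x / D := by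
    rw [← Nat.floor_div_natCast]
    exact Nat.floor_le hx'
  have h2 : x / D < ((⌊x⌋₊ / D : ℕ) : ℝ) + 1 := by
    rw [← Nat.floor_div_natCast]
    exact Nat.lt_floor_add_one _
  have h3 : (0 : ℝ) ≤ ((⌊x⌋₊ / D : ℕ) : ℝ) := Nat.cast_nonneg _
  have h4 : ‖((⌊x⌋₊ / D : ℕ) : ℂ) - (x : ℂ) / (D : ℂ)‖
      = |((⌊x⌋₊ / D : ℕ) : ℝ) - x / D| := by
    rw [← Real.norm_eq_abs, ← Complex.norm_real]
    simp only [Complex.ofReal_sub, Complex.ofReal_div, Complex.ofReal_natCast]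
  rw [h4, abs_le, abs_le]
  refine ⟨⟨?_, ?_⟩, ?_, ?_⟩ <;> linarith

lemma div_succ_pow_le_cube {t x : ℝ} (hx : 0 ≤ x) (htx : t ^ 3 = x) {β : ℕ} (hβ : 3 ≤ β) (k : ℕ) :
    x / (((k + 1) ^ β : ℕ) : ℝ) ≤ t ^ 3 / ((k : ℝ) + 1) ^ 3 := by
  rw [htx]
  push_cast
  gcongr
  simp

lemma norm_sum_sigmaGen_sub_le {z : ℂ} (hz : z.re ≤ 0) {β : ℕ} (hβ : 3 ≤ β) {t x : ℝ}
    (ht : 0 < t) (htx : t ^ 3 = x) :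
    ‖∑ n ∈ Finset.Icc 1 ⌊x⌋₊, sigmaGen z β n - riemannZeta ((β : ℂ) * (1 - z)) * x‖ ≤ 4 * t := by
  have hx : 0 ≤ x := htx ▸ by positivity
  have hre : ((β : ℂ) * z).re ≤ 0 := by
    simpa using mul_nonpos_of_nonneg_of_nonpos β.cast_nonneg hz
  have H := (hasSum_sum_sigmaGen_sub z hz (by omega : 2 ≤ β) ⌊x⌋₊ x).tendsto_sum_nat.norm
  refine le_of_tendsto' H fun K => (norm_sum_le _ _).trans ?_
  have hterm : ∀ k : ℕ, ‖((k + 1 : ℕ) : ℂ) ^ ((β : ℂ) * z) *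
        (((⌊x⌋₊ / (k + 1) ^ β : ℕ) : ℂ) - (x : ℂ) / ((k + 1 : ℕ) : ℂ) ^ β)‖
      ≤ ‖((⌊x⌋₊ / (k + 1) ^ β : ℕ) : ℂ) - (x : ℂ) / (((k + 1) ^ β : ℕ) : ℂ)‖ := fun k => by
    rw [norm_mul, Nat.cast_pow]
    exact mul_le_of_le_one_left (norm_nonneg _) (norm_natCast_succ_cpow_le_one k hre)
  exact sum_range_le_of_le_one_of_le_cube ht
    (fun k => (hterm k).trans (norm_natCast_floor_div_sub_le hx).1)
    (fun k => (hterm k).trans ((norm_natCast_floor_div_sub_le hx).2.trans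
      (div_succ_pow_le_cube hx htx hβ k))) K

lemma norm_sigmaGen_le {z : ℂ} (hz : z.re ≤ 0) {β : ℕ} (hβ : 3 ≤ β) {n : ℕ} (hn : 0 < n) {t : ℝ}
    (ht : 0 < t) (htn : t ^ 3 = n) : ‖sigmaGen z β n‖ ≤ 4 * t := by
  have hre : ((β : ℂ) * z).re ≤ 0 := by
    simpa using mul_nonpos_of_nonneg_of_nonpos β.cast_nonneg hz
  rw [sigmaGen_eq_sum_range z (by omega) hn le_rfl]
  refine (norm_sum_le _ _).trans (sum_range_le_of_le_one_of_le_cube ht (fun k => ?_) (fun k => ?_) n)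
  · split_ifs
    · exact norm_natCast_succ_cpow_le_one k hre
    · simp
  · split_ifs with h
    · refine (norm_natCast_succ_cpow_le_one k hre).trans
        (le_trans ?_ (div_succ_pow_le_cube n.cast_nonneg htn hβ k))
      rw [one_le_div (by positivity)]
      exact_mod_cast Nat.le_of_dvd hn h
    · rw [norm_zero]
      positivity

theorem sigma_sum_large_beta (z : ℂ) (h1 : -1 < z.re) (h2 : z.re ≤ 0) :
    ∃ C > 0, ∀ β : ℕ, 3 ≤ β → ∀ x : ℝ, 3 ≤ x →
      ‖primedSum (sigmaGen z β) x - riemannZeta ((β : ℂ) * (1 - z)) * (x : ℂ)‖ ≤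
        C * (x ^ ((1 : ℝ) / 3) * (Real.log x) ^ 2) := by
  refine ⟨6, by norm_num, fun β hβ x hx => ?_⟩
  have hx0 : 0 < x := by linarith
  set t := x ^ ((1 : ℝ) / 3) with ht_def
  have ht : 0 < t := by positivity
  have htx : t ^ 3 = x := by
    rw [ht_def, ← Real.rpow_natCast, ← Real.rpow_mul hx0.le]
    norm_num
  have hlog : 1 ≤ Real.log x := by
    rw [Real.le_log_iff_exp_le hx0]
    linarith [Real.exp_one_lt_d9]
  have hhalf : ‖if (⌊x⌋₊ : ℝ) = x then sigmaGen z β ⌊x⌋₊ / 2 else 0‖ ≤ 2 * t := by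
    split_ifs with h
    · have := norm_sigmaGen_le h2 hβ (Nat.floor_pos.2 (by linarith)) ht (htx.trans h.symm)
      rw [norm_div, Complex.norm_ofNat]
      linarith
    · rw [norm_zero]
      positivity
  calc _ = ‖(∑ n ∈ Finset.Icc 1 ⌊x⌋₊, sigmaGen z β n - riemannZeta ((β : ℂ) * (1 - z)) * x)
        - if (⌊x⌋₊ : ℝ) = x then sigmaGen z β ⌊x⌋₊ / 2 else 0‖ := by
        rw [primedSum, sub_right_comm]
    _ ≤ 4 * t + 2 * t :=
        (norm_sub_le _ _).trans (add_le_add (norm_sum_sigmaGen_sub_le h2 hβ ht htx) hhalf)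
    _ = 6 * (t * 1) := by ring
    _ ≤ 6 * (t * Real.log x ^ 2) := by
        gcongr
        exact one_le_pow₀ hlog
end

section
/- Let β be a positive integer, z₁, z₂ ∈ ℂ, and s ∈ ℂ with Re(s) > max(1, Re(z₁) + 1/β, Re(z₂) + 1/β, Re(z₁ + z₂) + 1/β). Then the series Σ_{n=1}^∞ σ_{z₁,β}(n)·σ_{z₂,β}(n)·n^{−s} converges absolutely and Σ_{n=1}^∞ σ_{z₁,β}(n)σ_{z₂,β}(n)·n^{−s} = ζ(s)·ζ(β(s − z₁))·ζ(β(s − z₂))·ζ(β(s − z₁ − z₂)) / ζ(β(2s − z₁ − z₂)). -/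
open Complex Finset
open scoped Classical

theorem hasSum_pnat_iff_of_zero {f : ℕ → ℂ} {a : ℂ} (hf : f 0 = 0) :
    HasSum (fun n : ℕ+ => f n) a ↔ HasSum f a := by
  refine PNat.coe_injective.hasSum_iff fun n hn => ?_
  obtain rfl : n = 0 := by
    by_contra hn0
    exact hn ⟨⟨n, Nat.pos_of_ne_zero hn0⟩, rfl⟩
  exact hf

theorem hasSum_pnat_cpow_neg {u : ℂ} (hu : 1 < u.re) :
    HasSum (fun n : ℕ+ => (n : ℂ) ^ (-u)) (riemannZeta u) := by
  have hu0 : -u ≠ 0 := neg_ne_zero.mpr (by rintro rfl; simp at hu; linarith)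
  have h : HasSum (fun n : ℕ => (n : ℂ) ^ (-u)) (riemannZeta u) := by
    have h' := (Complex.summable_one_div_nat_cpow.mpr hu).hasSum
    rw [← zeta_eq_tsum_one_div_nat_cpow hu] at h'
    simpa only [one_div, Complex.cpow_neg] using h'
  exact (hasSum_pnat_iff_of_zero (by simp [Complex.zero_cpow hu0])).mpr h

/-- The map `(g, (a, b)) ↦ (g * a, g * b)` from positive integers and coprime pairs to pairs. -/
def coprimePairScale (q : ℕ+ × {p : ℕ+ × ℕ+ // Nat.Coprime p.1 p.2}) : ℕ+ × ℕ+ :=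
  (q.1 * q.2.1.1, q.1 * q.2.1.2)

theorem coprimePairScale_bijective : Function.Bijective coprimePairScale := by
  constructor
  · rintro ⟨g, ⟨a, b⟩, h⟩ ⟨g', ⟨a', b'⟩, h'⟩ he
    simp only [coprimePairScale, Prod.mk.injEq] at he h h'
    obtain ⟨h1, h2⟩ := he
    have e1 := congrArg PNat.val h1
    have e2 := congrArg PNat.val h2
    rw [PNat.mul_coe, PNat.mul_coe] at e1 e2
    have hg : g = g' := by
      apply PNat.coe_injective
      have := congrArg₂ Nat.gcd e1 e2
      rwa [Nat.gcd_mul_left, Nat.gcd_mul_left, h.gcd_eq_one, h'.gcd_eq_one, mul_one, mul_one]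
        at this
    subst hg
    simp only [mul_right_inj] at h1 h2
    subst h1 h2
    rfl
  · rintro ⟨x, y⟩
    obtain ⟨a, b, hab, hx, hy⟩ := Nat.exists_coprime (x : ℕ) (y : ℕ)
    have ha : 0 < a := Nat.pos_of_ne_zero (by rintro rfl; simp at hx)
    have hb : 0 < b := Nat.pos_of_ne_zero (by rintro rfl; simp at hy)
    refine ⟨(⟨Nat.gcd x y, Nat.gcd_pos_of_pos_left _ x.pos⟩, ⟨(⟨a, ha⟩, ⟨b, hb⟩), hab⟩), ?_⟩
    simp only [coprimePairScale, Prod.mk.injEq]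
    constructor <;> apply PNat.coe_injective
    · exact (mul_comm _ _).trans hx.symm
    · exact (mul_comm _ _).trans hy.symm

theorem HasSum.mul_prod_of_complex {ι κ : Type*} {f : ι → ℂ} {g : κ → ℂ} {a b : ℂ}
    (hf : HasSum f a) (hg : HasSum g b) : HasSum (fun p : ι × κ => f p.1 * g p.2) (a * b) :=
  hf.mul hg (summable_mul_of_summable_norm hf.summable.norm hg.summable.norm)

theorem hasSum_coprime_pairs {u v : ℂ} (hu : 1 < u.re) (hv : 1 < v.re) :
    HasSum (fun p : {p : ℕ+ × ℕ+ // Nat.Coprime p.1 p.2} =>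
      (p.1.1 : ℂ) ^ (-u) * (p.1.2 : ℂ) ^ (-v))
      (riemannZeta u * riemannZeta v / riemannZeta (u + v)) := by
  have huv : 1 < (u + v).re := by rw [Complex.add_re]; linarith
  have hpairs := (hasSum_pnat_cpow_neg hu).mul_prod_of_complex (hasSum_pnat_cpow_neg hv)
  obtain ⟨C, hC⟩ : Summable (fun p : {p : ℕ+ × ℕ+ // Nat.Coprime p.1 p.2} =>
      (p.1.1 : ℂ) ^ (-u) * (p.1.2 : ℂ) ^ (-v)) := hpairs.summable.subtype _
  have hscaled := (hasSum_pnat_cpow_neg huv).mul_prod_of_complex hC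
  have hpairs' := (Equiv.ofBijective _ coprimePairScale_bijective).hasSum_iff.mpr hpairs
  have hEq : riemannZeta u * riemannZeta v = riemannZeta (u + v) * C := by
    refine hpairs'.unique (hscaled.congr_fun ?_)
    rintro ⟨g, ⟨a, b⟩, h⟩
    have hg : (g : ℂ) ≠ 0 := by simp
    simp only [Function.comp, Equiv.ofBijective_apply, coprimePairScale, PNat.mul_coe,
      Nat.cast_mul, Complex.natCast_mul_natCast_cpow, neg_add, Complex.cpow_add _ _ hg]
    ring
  rwa [hEq, mul_div_cancel_left₀ _ (riemannZeta_ne_zero_of_one_lt_re huv)]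

theorem hasSum_pairs_lcm {x y t : ℂ} (hx : 1 < (t - x).re) (hy : 1 < (t - y).re)
    (hxy : 1 < (t - x - y).re) :
    HasSum (fun p : ℕ+ × ℕ+ =>
      (p.1 : ℂ) ^ x * (p.2 : ℂ) ^ y * (Nat.lcm p.1 p.2 : ℂ) ^ (-t))
      (riemannZeta (t - x - y) *
        (riemannZeta (t - x) * riemannZeta (t - y) / riemannZeta (2 * t - x - y))) := by
  rw [← (Equiv.ofBijective _ coprimePairScale_bijective).hasSum_iff]
  have h := (hasSum_pnat_cpow_neg hxy).mul_prod_of_complex (hasSum_coprime_pairs hx hy)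
  rw [show t - x + (t - y) = 2 * t - x - y by ring] at h
  refine h.congr_fun ?_
  rintro ⟨g, ⟨a, b⟩, hab⟩
  have hg : (g : ℂ) ≠ 0 := by simp
  have ha : (a : ℂ) ≠ 0 := by simp
  have hb : (b : ℂ) ≠ 0 := by simp
  simp only at hab
  simp only [Function.comp, Equiv.ofBijective_apply, coprimePairScale, PNat.mul_coe,
    Nat.lcm_mul_left, hab.lcm_eq_mul]
  simp only [Nat.cast_mul (g : ℕ), Complex.natCast_mul_natCast_cpow]
  simp only [Nat.cast_mul (a : ℕ), Complex.natCast_mul_natCast_cpow]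
  rw [show -(t - x - y) = x + y + -t by ring, show -(t - x) = x + -t by ring,
    show -(t - y) = y + -t by ring]
  simp only [Complex.cpow_add _ _ hg, Complex.cpow_add _ _ ha, Complex.cpow_add _ _ hb]
  ring

theorem hasSum_sigmaGen (z : ℂ) {β : ℕ} (hβ : 0 < β) (n : ℕ+) :
    HasSum (fun d : ℕ+ => if (d : ℕ) ^ β ∣ n then (d : ℂ) ^ ((β : ℂ) * z) else 0)
      (sigmaGen z β n) := by
  let f : ℕ → ℂ := fun d => if d ∈ Finset.Icc 1 (n : ℕ) then
    (if d ^ β ∣ n then (d : ℂ) ^ ((β : ℂ) * z) else 0) else 0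
  have hf : HasSum f (sigmaGen z β n) := by
    have h : HasSum f (∑ d ∈ Finset.Icc 1 (n : ℕ), f d) :=
      hasSum_sum_of_ne_finset_zero fun d hd => if_neg hd
    convert h using 1
    rw [sigmaGen, Finset.sum_filter]
    exact Finset.sum_congr rfl fun d hd => (if_pos hd).symm
  refine ((hasSum_pnat_iff_of_zero (f := f) (by simp [f])).mpr hf).congr_fun fun d => ?_
  by_cases hdn : (d : ℕ) ^ β ∣ n
  · have hle : (d : ℕ) ≤ n :=
      (Nat.le_self_pow hβ.ne' _).trans (Nat.le_of_dvd n.pos hdn)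
    simp [f, hle]
  · simp [f, hdn]

theorem lcm_pow_scale_injective (β : ℕ) : Function.Injective
    (fun q : ℕ+ × (ℕ+ × ℕ+) => (q.1 * PNat.lcm q.2.1 q.2.2 ^ β, q.2)) := by
  rintro ⟨m, p⟩ ⟨m', p'⟩ h
  simp only [Prod.mk.injEq] at h
  obtain ⟨h1, rfl⟩ := h
  rw [mul_left_inj] at h1
  rw [h1]

theorem hasSum_pow_dvd_pairs (β : ℕ) {x y s A B : ℂ}
    (hA : HasSum (fun n : ℕ+ => (n : ℂ) ^ (-s)) A)
    (hB : HasSum (fun p : ℕ+ × ℕ+ => (p.1 : ℂ) ^ x * (p.2 : ℂ) ^ y *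
      (Nat.lcm p.1 p.2 : ℂ) ^ (-((β : ℂ) * s))) B) :
    HasSum (fun q : ℕ+ × (ℕ+ × ℕ+) =>
      (if (q.2.1 : ℕ) ^ β ∣ q.1 then (q.2.1 : ℂ) ^ x else 0) *
        (if (q.2.2 : ℕ) ^ β ∣ q.1 then (q.2.2 : ℂ) ^ y else 0) * (q.1 : ℂ) ^ (-s)) (A * B) := by
  rw [← (lcm_pow_scale_injective β).hasSum_iff]
  · refine (hA.mul_prod_of_complex hB).congr_fun ?_
    rintro ⟨m, a, b⟩
    have h1 : (a : ℕ) ^ β ∣ (m : ℕ) * Nat.lcm a b ^ β :=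
      (pow_dvd_pow_of_dvd (Nat.dvd_lcm_left _ _) _).mul_left _
    have h2 : (b : ℕ) ^ β ∣ (m : ℕ) * Nat.lcm a b ^ β :=
      (pow_dvd_pow_of_dvd (Nat.dvd_lcm_right _ _) _).mul_left _
    have h3 : (Nat.lcm a b : ℂ) ^ (-((β : ℂ) * s)) = ((Nat.lcm a b ^ β : ℕ) : ℂ) ^ (-s) := by
      rw [← mul_neg, Complex.natCast_cpow_natCast_mul, Nat.cast_pow]
    simp only [Function.comp, PNat.mul_coe, PNat.pow_coe, PNat.lcm_coe, h1, h2, if_true, h3]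
    rw [Nat.cast_mul, Complex.natCast_mul_natCast_cpow]
    ring
  · rintro ⟨n, a, b⟩ hq
    by_cases h1 : (a : ℕ) ^ β ∣ n
    · by_cases h2 : (b : ℕ) ^ β ∣ n
      · exfalso
        have h3 : PNat.lcm a b ^ β ∣ n := by
          rw [PNat.dvd_iff, PNat.pow_coe, PNat.lcm_coe, ← Nat.pow_lcm_pow]
          exact Nat.lcm_dvd h1 h2
        obtain ⟨m, rfl⟩ := h3
        exact hq ⟨(m, (a, b)), Prod.ext (mul_comm _ _) rfl⟩
      · simp [h2]
    · simp [h1]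

theorem hasSum_sigmaGen_mul {β : ℕ} (hβ : 0 < β) {z₁ z₂ s A B : ℂ}
    (hA : HasSum (fun n : ℕ+ => (n : ℂ) ^ (-s)) A)
    (hB : HasSum (fun p : ℕ+ × ℕ+ => (p.1 : ℂ) ^ ((β : ℂ) * z₁) * (p.2 : ℂ) ^ ((β : ℂ) * z₂) *
      (Nat.lcm p.1 p.2 : ℂ) ^ (-((β : ℂ) * s))) B) :
    HasSum (fun n : ℕ => sigmaGen z₁ β n * sigmaGen z₂ β n * (n : ℂ) ^ (-s)) (A * B) := by
  rw [← hasSum_pnat_iff_of_zero (by simp [sigmaGen])]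
  refine (hasSum_pow_dvd_pairs β hA hB).prod_fiberwise fun n => ?_
  have h := (hasSum_sigmaGen z₁ hβ n).mul_prod_of_complex (hasSum_sigmaGen z₂ hβ n)
  exact h.mul_right ((n : ℂ) ^ (-s))

theorem sigma_product_dirichlet_series (β : ℕ) (hβ : 0 < β) (z₁ z₂ s : ℂ)
    (hs : max (max 1 (z₁.re + 1 / (β : ℝ)))
            (max (z₂.re + 1 / (β : ℝ)) ((z₁ + z₂).re + 1 / (β : ℝ))) < s.re) :
    Summable (fun n : ℕ => ‖sigmaGen z₁ β n * sigmaGen z₂ β n * (n : ℂ) ^ (-s)‖) ∧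
    ∑' n : ℕ, sigmaGen z₁ β n * sigmaGen z₂ β n * (n : ℂ) ^ (-s) =
      riemannZeta s * riemannZeta ((β : ℂ) * (s - z₁)) * riemannZeta ((β : ℂ) * (s - z₂)) *
        riemannZeta ((β : ℂ) * (s - z₁ - z₂)) / riemannZeta ((β : ℂ) * (2 * s - z₁ - z₂)) := by
  simp only [max_lt_iff] at hs
  obtain ⟨⟨h1, h2⟩, h3, h4⟩ := hs
  have hβ' : (0 : ℝ) < β := Nat.cast_pos.mpr hβ
  have key (w : ℂ) (hw : w.re + 1 / (β : ℝ) < s.re) : 1 < ((β : ℂ) * s - β * w).re := by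
    rw [← mul_sub, ← Complex.ofReal_natCast, Complex.re_ofReal_mul, Complex.sub_re]
    have : 1 / (β : ℝ) < s.re - w.re := by linarith
    rwa [div_lt_iff₀' hβ'] at this
  have h := hasSum_sigmaGen_mul hβ (hasSum_pnat_cpow_neg h1)
    (hasSum_pairs_lcm (key z₁ h2) (key z₂ h3) (by rw [sub_sub, ← mul_add]; exact key _ h4))
  refine ⟨h.summable.norm, h.tsum_eq.trans ?_⟩
  rw [show (β : ℂ) * s - β * z₁ - β * z₂ = β * (s - z₁ - z₂) by ring,
    show (β : ℂ) * s - β * z₁ = β * (s - z₁) by ring,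
    show (β : ℂ) * s - β * z₂ = β * (s - z₂) by ring,
    show 2 * ((β : ℂ) * s) - β * z₁ - β * z₂ = β * (2 * s - z₁ - z₂) by ring]
  ring
end
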